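/- Let f : (-1,1) → ℝ be measurable with f(x)·(1-x²)^{1/4} ∈ L²(-1,1). Then the weighted L² norm of the finite Hilbert transform does not increase: ∫_{-1}^{1} (Hf)(x)² √(1-x²) dx ≤ ∫_{-1}^{1} f(x)² √(1-x²) dx. -/

import Mathlib

open MeasureTheory Filter Set Real

/-- The truncated finite Hilbert transform of `f` on `(-1,1)` at `x`. -/
noncomputable def truncatedFiniteHilbert (f : ℝ → ℝ) (x ε : ℝ) : ℝ :=
  (1 / π) * ∫ y in Ioo (-1 : ℝ) 1 \ Ioo (x - ε) (x + ε), f y / (x - y)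

/-- `L` is the value of the finite Hilbert transform at `x`, as a limit as `ε → 0⁺`. -/
def HasFiniteHilbertAt (f : ℝ → ℝ) (x L : ℝ) : Prop :=
  Tendsto (fun ε => truncatedFiniteHilbert f x ε) (nhdsWithin 0 (Ioi 0)) (nhds L)

lemma integral_cos_int_mul (k : ℤ) :
    ∫ x in (0 : ℝ)..π, cos (k * x) = if k = 0 then π else 0 := by
  split_ifs with h
  · simp [h]
  · have hk : (k : ℝ) ≠ 0 := by exact_mod_cast h
    rw [intervalIntegral.integral_comp_mul_left (fun x => cos x) hk]
    simp [integral_cos, Real.sin_int_mul_pi]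

lemma integral_cos_succ_mul_cos_succ (m n : ℕ) :
    ∫ x in (0 : ℝ)..π, cos ((m + 1) * x) * cos ((n + 1) * x) = if m = n then π / 2 else 0 := by
  have h : ∀ x : ℝ, cos ((m + 1) * x) * cos ((n + 1) * x)
      = (cos (((m - n : ℤ) : ℝ) * x) + cos (((m + n + 2 : ℤ) : ℝ) * x)) / 2 := by
    intro x
    have h1 : ((m - n : ℤ) : ℝ) * x = (m + 1) * x - (n + 1) * x := by push_cast; ring
    have h2 : ((m + n + 2 : ℤ) : ℝ) * x = (m + 1) * x + (n + 1) * x := by push_cast; ring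
    rw [h1, h2, cos_sub, cos_add]; ring
  simp_rw [h]
  rw [intervalIntegral.integral_div, intervalIntegral.integral_add
    (Continuous.intervalIntegrable (by fun_prop) _ _)
    (Continuous.intervalIntegrable (by fun_prop) _ _), integral_cos_int_mul, integral_cos_int_mul,
    if_neg (show ¬ ((m : ℤ) + n + 2 = 0) by omega)]
  by_cases hmn : m = n
  · simp [hmn]
  · rw [if_neg (by omega), if_neg hmn]; simp

lemma integral_sin_succ_mul_sin_succ (m n : ℕ) :
    ∫ x in (0 : ℝ)..π, sin ((m + 1) * x) * sin ((n + 1) * x) = if m = n then π / 2 else 0 := by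
  have h : ∀ x : ℝ, sin ((m + 1) * x) * sin ((n + 1) * x)
      = (cos (((m - n : ℤ) : ℝ) * x) - cos (((m + n + 2 : ℤ) : ℝ) * x)) / 2 := by
    intro x
    have h1 : ((m - n : ℤ) : ℝ) * x = (m + 1) * x - (n + 1) * x := by push_cast; ring
    have h2 : ((m + n + 2 : ℤ) : ℝ) * x = (m + 1) * x + (n + 1) * x := by push_cast; ring
    rw [h1, h2, cos_sub, cos_add]; ring
  simp_rw [h]
  rw [intervalIntegral.integral_div, intervalIntegral.integral_sub
    (Continuous.intervalIntegrable (by fun_prop) _ _)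
    (Continuous.intervalIntegrable (by fun_prop) _ _), integral_cos_int_mul, integral_cos_int_mul,
    if_neg (show ¬ ((m : ℤ) + n + 2 = 0) by omega)]
  by_cases hmn : m = n
  · simp [hmn]
  · rw [if_neg (by omega), if_neg hmn]; simp

lemma integrableOn_Ioo_of_continuous {h : ℝ → ℝ} (hh : Continuous h) (a b : ℝ) :
    IntegrableOn h (Ioo a b) :=
  (hh.integrableOn_Icc).mono_set Ioo_subset_Icc_self

lemma integral_sq_sum_of_orthogonal {e : ℕ → ℝ → ℝ} (he : ∀ n, Continuous (e n))
    (horth : ∀ m n, ∫ x in (0 : ℝ)..π, e m x * e n x = if m = n then π / 2 else 0)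
    (a : ℕ → ℝ) (N : ℕ) :
    ∫ x in Ioo 0 π, (∑ n ∈ Finset.range N, a n * e n x) ^ 2
      = π / 2 * ∑ n ∈ Finset.range N, a n ^ 2 := by
  have horth' : ∀ m n, ∫ x in Ioo 0 π, e m x * e n x = if m = n then π / 2 else 0 := by
    intro m n
    rw [← horth m n, intervalIntegral.integral_of_le pi_pos.le, integral_Ioc_eq_integral_Ioo]
  have h : ∀ x, (∑ n ∈ Finset.range N, a n * e n x) ^ 2
      = ∑ m ∈ Finset.range N, ∑ n ∈ Finset.range N, a m * a n * (e m x * e n x) := by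
    intro x
    rw [sq, Finset.sum_mul_sum]
    exact Finset.sum_congr rfl fun m _ => Finset.sum_congr rfl fun n _ => by ring
  simp_rw [h]
  rw [integral_finsetSum _ fun m _ => integrableOn_Ioo_of_continuous (by fun_prop) _ _,
    Finset.mul_sum]
  refine Finset.sum_congr rfl fun m hm => ?_
  rw [integral_finsetSum _ fun n _ => integrableOn_Ioo_of_continuous (by fun_prop) _ _]
  simp_rw [integral_const_mul, horth']
  simp only [mul_ite, mul_zero, Finset.sum_ite_eq, hm, if_true]
  ring

/-- Bessel's inequality for the cosine system on `(0, π)`. -/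
lemma bessel_cos {g : ℝ → ℝ} (hg : IntegrableOn g (Ioo 0 π))
    (hg2 : IntegrableOn (fun x => g x ^ 2) (Ioo 0 π)) (N : ℕ) :
    2 / π * ∑ n ∈ Finset.range N, (∫ x in Ioo 0 π, g x * cos ((n + 1) * x)) ^ 2
      ≤ ∫ x in Ioo 0 π, g x ^ 2 := by
  set c : ℕ → ℝ := fun n => ∫ x in Ioo 0 π, g x * cos ((n + 1) * x) with hc
  set p : ℝ → ℝ := fun x => ∑ n ∈ Finset.range N, (2 / π * c n) * cos ((n + 1) * x) with hp
  have hpc : Continuous p := by fun_prop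
  have hgc : ∀ n : ℕ, IntegrableOn (fun x => g x * cos ((n + 1) * x)) (Ioo 0 π) := fun n =>
    hg.mul_bdd (c := 1) (Continuous.aestronglyMeasurable (by fun_prop))
      (Eventually.of_forall fun x => by simpa using abs_cos_le_one _)
  have hgp : ∀ x, g x * p x = ∑ n ∈ Finset.range N, (2 / π * c n) * (g x * cos ((n + 1) * x)) := by
    intro x
    rw [hp, Finset.mul_sum]
    exact Finset.sum_congr rfl fun n _ => by ring
  have hgpi : IntegrableOn (fun x => g x * p x) (Ioo 0 π) := by
    simp_rw [hgp]
    exact integrable_finsetSum _ fun n _ => (hgc n).const_mul _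
  have hgpv : ∫ x in Ioo 0 π, g x * p x = 2 / π * ∑ n ∈ Finset.range N, c n ^ 2 := by
    simp_rw [hgp]
    rw [integral_finsetSum _ fun n _ => (hgc n).const_mul _, Finset.mul_sum]
    refine Finset.sum_congr rfl fun n _ => ?_
    rw [integral_const_mul]; simp only [hc]; ring
  have hpp : ∫ x in Ioo 0 π, p x ^ 2 = 2 / π * ∑ n ∈ Finset.range N, c n ^ 2 := by
    rw [hp, integral_sq_sum_of_orthogonal (e := fun n x => cos ((n + 1) * x))
      (fun n => by fun_prop) integral_cos_succ_mul_cos_succ]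
    simp_rw [mul_pow]
    rw [← Finset.mul_sum]
    field_simp
  have hnn : 0 ≤ ∫ x in Ioo 0 π, (g x - p x) ^ 2 := integral_nonneg fun x => sq_nonneg _
  have hexp : ∀ x, (g x - p x) ^ 2 = (g x ^ 2 - 2 * (g x * p x)) + p x ^ 2 := fun x => by ring
  simp_rw [hexp] at hnn
  have hsub : IntegrableOn (fun x => g x ^ 2 - 2 * (g x * p x)) (Ioo 0 π) :=
    hg2.sub (hgpi.const_mul 2)
  rw [integral_add hsub (integrableOn_Ioo_of_continuous (by fun_prop) _ _),
    integral_sub hg2 (hgpi.const_mul 2), integral_const_mul, hgpv, hpp] at hnn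
  linarith

lemma integral_sq_sin_series_le {g : ℝ → ℝ} (hg : IntegrableOn g (Ioo 0 π))
    (hg2 : IntegrableOn (fun x => g x ^ 2) (Ioo 0 π)) {r : ℝ} (hr0 : 0 ≤ r) (hr1 : r ≤ 1) (N : ℕ) :
    ∫ θ in Ioo 0 π, (∑ n ∈ Finset.range N,
      (2 / π * (r ^ (n + 1) * ∫ x in Ioo 0 π, g x * cos ((n + 1) * x))) * sin ((n + 1) * θ)) ^ 2
      ≤ ∫ x in Ioo 0 π, g x ^ 2 := by
  rw [integral_sq_sum_of_orthogonal (e := fun n x => sin ((n + 1) * x))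
      (fun n => by fun_prop) integral_sin_succ_mul_sin_succ]
  refine le_trans ?_ (bessel_cos hg hg2 N)
  rw [Finset.mul_sum, Finset.mul_sum]
  refine Finset.sum_le_sum fun n _ => ?_
  have h1 : (r ^ (n + 1)) ^ 2 ≤ 1 := pow_le_one₀ (by positivity) (pow_le_one₀ hr0 hr1)
  set c := ∫ x in Ioo 0 π, g x * cos ((n + 1) * x)
  calc π / 2 * (2 / π * (r ^ (n + 1) * c)) ^ 2 = 2 / π * ((r ^ (n + 1)) ^ 2 * c ^ 2) := by
        field_simp
    _ ≤ 2 / π * (1 * c ^ 2) := by gcongr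
    _ = _ := by ring

/-- A form of Fatou's lemma for squares. -/
lemma lintegral_sq_le_of_tendsto {α : Type*} [MeasurableSpace α] {μ : Measure α}
    {u : ℕ → α → ℝ} {v : α → ℝ} {A : ENNReal} (hu : ∀ n, AEMeasurable (u n) μ)
    (hA : ∀ n, ∫⁻ x, ENNReal.ofReal (u n x ^ 2) ∂μ ≤ A)
    (hlim : ∀ᵐ x ∂μ, Tendsto (fun n => u n x) atTop (nhds (v x))) :
    ∫⁻ x, ENNReal.ofReal (v x ^ 2) ∂μ ≤ A := by
  calc ∫⁻ x, ENNReal.ofReal (v x ^ 2) ∂μ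
      = ∫⁻ x, liminf (fun n => ENNReal.ofReal (u n x ^ 2)) atTop ∂μ := by
        refine lintegral_congr_ae ?_
        filter_upwards [hlim] with x hx
        exact ((ENNReal.continuous_ofReal.tendsto _).comp (hx.pow 2)).liminf_eq.symm
    _ ≤ liminf (fun n => ∫⁻ x, ENNReal.ofReal (u n x ^ 2) ∂μ) atTop :=
        lintegral_liminf_le' fun n => ((hu n).pow_const 2).ennreal_ofReal
    _ ≤ A := liminf_le_of_frequently_le' (Frequently.of_forall hA)

lemma hasSum_pow_mul_sin {r : ℝ} (hr0 : 0 ≤ r) (hr1 : r < 1) (t : ℝ) :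
    HasSum (fun n : ℕ => r ^ (n + 1) * sin ((n + 1) * t))
      (r * sin t / (1 - 2 * r * cos t + r ^ 2)) := by
  set z : ℂ := r * Complex.exp (t * Complex.I) with hz
  have hzn : ‖z‖ < 1 := by
    rw [hz, norm_mul, Complex.norm_exp_ofReal_mul_I, mul_one, Complex.norm_real, norm_eq_abs,
      abs_of_nonneg hr0]
    exact hr1
  have hs := (hasSum_geometric_of_norm_lt_one hzn).mul_left z
  have hs' := Complex.hasSum_im hs
  have hre : z.re = r * cos t := by simp [hz, Complex.exp_re]
  have him : z.im = r * sin t := by simp [hz, Complex.exp_im]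
  convert hs' using 1
  · funext n
    rw [← pow_succ', hz, mul_pow, ← Complex.exp_nat_mul, ← Complex.ofReal_pow, Complex.im_ofReal_mul]
    congr 1
    rw [show ((n + 1 : ℕ) : ℂ) * (t * Complex.I) = (((n + 1) * t : ℝ) : ℂ) * Complex.I by
      push_cast; ring, Complex.exp_ofReal_mul_I_im]
  · have hsq : Complex.normSq (1 - z) = 1 - 2 * r * cos t + r ^ 2 := by
      rw [Complex.normSq_apply]
      simp only [Complex.sub_re, Complex.one_re, Complex.sub_im, Complex.one_im, hre, him]
      nlinarith [sin_sq_add_cos_sq t]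
    rw [← hsq]
    simp only [Complex.mul_im, Complex.inv_re, Complex.inv_im, Complex.sub_re, Complex.one_re,
      Complex.sub_im, Complex.one_im, hre, him]
    ring

/-- The Poisson regularisation, in elliptic coordinates, of the kernel `1 / (x - y)`. -/
noncomputable def ellipticKernel (η x y : ℝ) : ℝ :=
  (x - (1 + η) * y) / ((x - y) ^ 2 + η * (2 + η - 2 * x * y))

lemma hasSum_ellipticKernel {r : ℝ} (hr0 : 0 < r) (hr1 : r < 1) (θ φ : ℝ) :
    HasSum (fun n : ℕ => -(2 * (r ^ (n + 1) * (sin ((n + 1) * θ) * cos ((n + 1) * φ)))))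
      (sin θ * ellipticKernel ((1 - r) ^ 2 / (2 * r)) (cos θ) (cos φ)) := by
  have h := ((hasSum_pow_mul_sin hr0.le hr1 (θ + φ)).add
    (hasSum_pow_mul_sin hr0.le hr1 (θ - φ))).neg
  have hden : ∀ t : ℝ, 0 < 1 - 2 * r * cos t + r ^ 2 := fun t => by
    nlinarith [cos_le_one t, mul_pos (sub_pos.2 hr1) (sub_pos.2 hr1)]
  have hfun : (fun n : ℕ => -(2 * (r ^ (n + 1) * (sin ((n + 1) * θ) * cos ((n + 1) * φ)))))
      = fun n : ℕ => -(r ^ (n + 1) * sin ((n + 1) * (θ + φ))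
        + r ^ (n + 1) * sin ((n + 1) * (θ - φ))) := by
    funext n
    rw [mul_add, mul_sub, sin_add, sin_sub]; ring
  rw [hfun]
  suffices hval : sin θ * ellipticKernel ((1 - r) ^ 2 / (2 * r)) (cos θ) (cos φ)
      = -(r * sin (θ + φ) / (1 - 2 * r * cos (θ + φ) + r ^ 2)
        + r * sin (θ - φ) / (1 - 2 * r * cos (θ - φ) + r ^ 2)) by
    rw [hval]; exact h
  · have h1 := hden (θ + φ)
    have h2 := hden (θ - φ)
    rw [cos_add] at h1
    rw [cos_sub] at h2
    rw [cos_add, cos_sub, sin_add, sin_sub]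
    have hD : (cos θ - cos φ) ^ 2 + (1 - r) ^ 2 / (2 * r) *
        (2 + (1 - r) ^ 2 / (2 * r) - 2 * cos θ * cos φ)
        = (1 - 2 * r * (cos θ * cos φ - sin θ * sin φ) + r ^ 2) *
          (1 - 2 * r * (cos θ * cos φ + sin θ * sin φ) + r ^ 2) / (4 * r ^ 2) := by
      have e1 := sin_sq θ
      have e2 := sin_sq φ
      field_simp
      ring_nf
      rw [e1, e2]
      ring
    rw [ellipticKernel, hD, div_add_div _ _ h1.ne' h2.ne', ← neg_div]
    have h3 := h1.ne'
    have h4 := h2.ne'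
    rw [div_div_eq_mul_div, mul_div_assoc', div_left_inj' (mul_ne_zero h3 h4)]
    have e2 := sin_sq φ
    field_simp
    ring_nf
    rw [e2]
    ring

lemma hasDerivAt_neg_inv_one_add_sq (u : ℝ) :
    HasDerivAt (fun u : ℝ => -(1 + u ^ 2)⁻¹) (2 * u / (1 + u ^ 2) ^ 2) u := by
  have h0 : (1 + u ^ 2 : ℝ) ≠ 0 := by positivity
  refine (((hasDerivAt_pow 2 u).const_add 1).fun_inv h0).fun_neg.congr_deriv ?_
  norm_num
  ring

lemma integral_cauchyWeight {A : ℝ} (hA : 0 ≤ A) :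
    ∫ u in Ioc 0 A, 2 * u / (1 + u ^ 2) ^ 2 = A ^ 2 / (1 + A ^ 2) := by
  have hc : Continuous fun u : ℝ => 2 * u / (1 + u ^ 2) ^ 2 :=
    Continuous.div₀ (by fun_prop) (by fun_prop) fun u => by positivity
  rw [← intervalIntegral.integral_of_le hA,
    intervalIntegral.integral_eq_sub_of_hasDerivAt (fun u _ => hasDerivAt_neg_inv_one_add_sq u) (hc.intervalIntegrable _ _)]
  have h0 : (1 + A ^ 2 : ℝ) ≠ 0 := by positivity
  field_simp
  ring

lemma integral_Ioi_cauchyWeight :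
    IntegrableOn (fun u : ℝ => 2 * u / (1 + u ^ 2) ^ 2) (Ioi 0) ∧
      ∫ u in Ioi (0 : ℝ), 2 * u / (1 + u ^ 2) ^ 2 = 1 := by
  have hd : ∀ u ∈ Ici (0 : ℝ),
      HasDerivAt (fun u => -(1 + u ^ 2)⁻¹) (2 * u / (1 + u ^ 2) ^ 2) u :=
    fun u _ => hasDerivAt_neg_inv_one_add_sq u
  have hnn : ∀ u ∈ Ioi (0 : ℝ), 0 ≤ 2 * u / (1 + u ^ 2) ^ 2 := fun u hu => by
    have : 0 < u := hu
    positivity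
  have hlim : Tendsto (fun u : ℝ => -(1 + u ^ 2)⁻¹) atTop (nhds 0) := by
    have h : Tendsto (fun u : ℝ => 1 + u ^ 2) atTop atTop :=
      tendsto_atTop_add_const_left _ _ (tendsto_pow_atTop two_ne_zero)
    simpa using h.inv_tendsto_atTop.neg
  refine ⟨integrableOn_Ioi_deriv_of_nonneg' hd hnn hlim, ?_⟩
  rw [integral_Ioi_of_hasDerivAt_of_nonneg' hd hnn hlim]
  simp

lemma setIntegral_diff_Ioo_eq (f : ℝ → ℝ) (x s : ℝ) :
    ∫ y in Ioo (-1 : ℝ) 1 \ Ioo (x - s) (x + s), f y / (x - y)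
      = ∫ y in Ioo (-1 : ℝ) 1, if s ≤ |x - y| then f y / (x - y) else 0 := by
  have h : (fun y => if s ≤ |x - y| then f y / (x - y) else 0)
      = (Ioo (x - s) (x + s))ᶜ.indicator fun y => f y / (x - y) := by
    funext y
    rw [indicator_apply]
    congr 1
    rw [mem_compl_iff, mem_Ioo, ← not_lt, abs_lt]
    apply propext
    constructor <;> intro h1 h2 <;> exact h1 ⟨by linarith [h2.1, h2.2], by linarith [h2.1, h2.2]⟩
  rw [h, setIntegral_indicator measurableSet_Ioo.compl, sdiff_eq]

lemma abs_truncated_integrand_le (f : ℝ → ℝ) (x y : ℝ) {s : ℝ} (hs : 0 < s) :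
    |if s ≤ |x - y| then f y / (x - y) else 0| ≤ s⁻¹ * |f y| := by
  split_ifs with h
  · rw [abs_div, div_eq_inv_mul]
    gcongr
  · rw [abs_zero]; positivity

lemma exists_bound_truncatedFiniteHilbert {f : ℝ → ℝ} {x L : ℝ}
    (hf : IntegrableOn f (Ioo (-1 : ℝ) 1)) (hL : HasFiniteHilbertAt f x L) :
    ∃ M, ∀ s, 0 < s → |truncatedFiniteHilbert f x s| ≤ M := by
  have hev : ∀ᶠ s in nhdsWithin 0 (Ioi 0), |truncatedFiniteHilbert f x s| < |L| + 1 :=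
    hL.abs.eventually_lt_const (lt_add_one _)
  obtain ⟨s₀, hs₀, h₀⟩ := mem_nhdsGT_iff_exists_Ioo_subset.1 hev
  have hs₀' : 0 < s₀ := hs₀
  refine ⟨max (|L| + 1) (1 / π * (s₀⁻¹ * ∫ y in Ioo (-1 : ℝ) 1, |f y|)), fun s hs => ?_⟩
  rcases lt_or_ge s s₀ with h | h
  · exact (le_of_lt (h₀ ⟨hs, h⟩)).trans (le_max_left _ _)
  · refine le_trans ?_ (le_max_right _ _)
    rw [truncatedFiniteHilbert, setIntegral_diff_Ioo_eq, abs_mul,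
      abs_of_pos (by positivity : 0 < 1 / π), ← integral_const_mul]
    gcongr
    rw [← norm_eq_abs]
    refine norm_integral_le_of_norm_le (hf.abs.const_mul _) (Eventually.of_forall fun y => ?_)
    refine (abs_truncated_integrand_le f x y hs).trans ?_
    gcongr

lemma integrable_weighted_truncation {f : ℝ → ℝ} (x : ℝ) {δ : ℝ} (hδ : 0 < δ)
    (hf : IntegrableOn f (Ioo (-1 : ℝ) 1)) :
    Integrable (Function.uncurry fun u y : ℝ =>
        2 * u / (1 + u ^ 2) ^ 2 * if δ * u ≤ |x - y| then f y / (x - y) else 0)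
      ((volume.restrict (Ioi 0)).prod (volume.restrict (Ioo (-1 : ℝ) 1))) := by
  have hh : Integrable (fun u : ℝ => 2 * δ⁻¹ * (1 + u ^ 2)⁻¹) (volume.restrict (Ioi 0)) :=
    (integrable_inv_one_add_sq.const_mul _).restrict
  refine (hh.mul_prod hf.abs).mono' ?_ ?_
  · have h1 : AEStronglyMeasurable (fun p : ℝ × ℝ => f p.2)
        ((volume.restrict (Ioi 0)).prod (volume.restrict (Ioo (-1 : ℝ) 1))) :=
      hf.aestronglyMeasurable.comp_snd
    have h2 : AEStronglyMeasurable (fun p : ℝ × ℝ => f p.2 * (x - p.2)⁻¹)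
        ((volume.restrict (Ioi 0)).prod (volume.restrict (Ioo (-1 : ℝ) 1))) :=
      h1.mul (by fun_prop : Measurable fun p : ℝ × ℝ => (x - p.2)⁻¹).aestronglyMeasurable
    have hS : MeasurableSet {p : ℝ × ℝ | δ * p.1 ≤ |x - p.2|} :=
      measurableSet_le (by fun_prop) (by fun_prop)
    refine AEStronglyMeasurable.mul
      (by fun_prop : Measurable fun p : ℝ × ℝ =>
        2 * p.1 / (1 + p.1 ^ 2) ^ 2).aestronglyMeasurable ?_
    convert h2.indicator hS using 1
    funext p
    simp [indicator_apply, div_eq_mul_inv]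
  · have hpos : ∀ᵐ p : ℝ × ℝ ∂((volume.restrict (Ioi 0)).prod
        (volume.restrict (Ioo (-1 : ℝ) 1))), p.1 ∈ Ioi (0 : ℝ) :=
      Measure.quasiMeasurePreserving_fst.ae (ae_restrict_mem measurableSet_Ioi)
    filter_upwards [hpos] with p hp
    have hp0 : 0 < p.1 := hp
    have h := abs_truncated_integrand_le f x p.2 (mul_pos hδ hp0)
    simp only [Function.uncurry, norm_eq_abs]
    rw [abs_mul, abs_of_pos (by positivity : 0 < 2 * p.1 / (1 + p.1 ^ 2) ^ 2)]
    calc _ ≤ 2 * p.1 / (1 + p.1 ^ 2) ^ 2 * ((δ * p.1)⁻¹ * |f p.2|) := by gcongr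
      _ = 2 * δ⁻¹ * ((1 + p.1 ^ 2) ^ 2)⁻¹ * |f p.2| := by field_simp
      _ ≤ 2 * δ⁻¹ * (1 + p.1 ^ 2)⁻¹ * |f p.2| := by
        gcongr
        exact le_self_pow₀ (by nlinarith [sq_nonneg p.1]) two_ne_zero

/-- The conjugate Poisson integral is an average of truncated Hilbert transforms. -/
lemma integral_truncatedFiniteHilbert_mul_cauchyWeight {f : ℝ → ℝ} (x : ℝ) {δ : ℝ} (hδ : 0 < δ)
    (hf : IntegrableOn f (Ioo (-1 : ℝ) 1)) :
    ∫ u in Ioi (0 : ℝ), 2 * u / (1 + u ^ 2) ^ 2 * truncatedFiniteHilbert f x (δ * u)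
      = 1 / π * ∫ y in Ioo (-1 : ℝ) 1, f y * ((x - y) / ((x - y) ^ 2 + δ ^ 2)) := by
  have hswap := integral_integral_swap (integrable_weighted_truncation x hδ hf)
  have h1 : ∀ u : ℝ, 2 * u / (1 + u ^ 2) ^ 2 * truncatedFiniteHilbert f x (δ * u)
      = 1 / π * ∫ y in Ioo (-1 : ℝ) 1,
        2 * u / (1 + u ^ 2) ^ 2 * if δ * u ≤ |x - y| then f y / (x - y) else 0 := by
    intro u
    rw [truncatedFiniteHilbert, setIntegral_diff_Ioo_eq, integral_const_mul]
    ring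
  simp_rw [h1]
  rw [integral_const_mul, hswap]
  congr 1
  refine integral_congr_ae (Eventually.of_forall fun y => ?_)
  have hind : (fun u : ℝ => 2 * u / (1 + u ^ 2) ^ 2 *
        if δ * u ≤ |x - y| then f y / (x - y) else 0)
      = (Iic (|x - y| / δ)).indicator fun u => 2 * u / (1 + u ^ 2) ^ 2 * (f y / (x - y)) := by
    funext u
    rw [indicator_apply]
    simp only [mem_Iic, le_div_iff₀' hδ, mul_ite, mul_zero]
  simp only
  rw [hind, setIntegral_indicator measurableSet_Iic, Ioi_inter_Iic, integral_mul_const,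
    integral_cauchyWeight (by positivity)]
  rcases eq_or_ne (x - y) 0 with h | h
  · simp [h]
  · have h2 : (x - y) ^ 2 + δ ^ 2 ≠ 0 := by positivity
    have h3 : (1 + (|x - y| / δ) ^ 2) = ((x - y) ^ 2 + δ ^ 2) / δ ^ 2 := by
      rw [div_pow, sq_abs]; field_simp; ring
    rw [h3, div_pow, sq_abs]
    field_simp

lemma tendsto_conjPoisson {f : ℝ → ℝ} {x L : ℝ}
    (hf : IntegrableOn f (Ioo (-1 : ℝ) 1)) (hL : HasFiniteHilbertAt f x L) :
    Tendsto (fun δ => 1 / π * ∫ y in Ioo (-1 : ℝ) 1, f y * ((x - y) / ((x - y) ^ 2 + δ ^ 2)))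
      (nhdsWithin 0 (Ioi 0)) (nhds L) := by
  obtain ⟨M, hM⟩ := exists_bound_truncatedFiniteHilbert hf hL
  have hlim : Tendsto (fun δ => ∫ u in Ioi (0 : ℝ),
      2 * u / (1 + u ^ 2) ^ 2 * truncatedFiniteHilbert f x (δ * u))
      (nhdsWithin 0 (Ioi 0)) (nhds (∫ u in Ioi (0 : ℝ), 2 * u / (1 + u ^ 2) ^ 2 * L)) := by
    refine tendsto_integral_filter_of_dominated_convergence
      (fun u => 2 * u / (1 + u ^ 2) ^ 2 * M) ?_ ?_ (integral_Ioi_cauchyWeight.1.mul_const M) ?_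
    · filter_upwards [self_mem_nhdsWithin] with δ hδ
      have h := ((integrable_weighted_truncation x hδ hf).integral_prod_left.const_mul
        (1 / π)).aestronglyMeasurable
      refine h.congr (Eventually.of_forall fun u => ?_)
      simp only [Function.uncurry]
      rw [truncatedFiniteHilbert, setIntegral_diff_Ioo_eq, integral_const_mul]
      ring
    · filter_upwards [self_mem_nhdsWithin] with δ hδ
      filter_upwards [ae_restrict_mem measurableSet_Ioi] with u hu
      have hu0 : 0 < u := hu
      have hδ0 : 0 < δ := hδ
      rw [norm_mul, norm_eq_abs, norm_eq_abs,
        abs_of_pos (by positivity : 0 < 2 * u / (1 + u ^ 2) ^ 2)]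
      gcongr
      exact hM _ (mul_pos hδ0 hu0)
    · filter_upwards [ae_restrict_mem measurableSet_Ioi] with u hu
      have hu0 : 0 < u := hu
      refine Tendsto.const_mul _ (hL.comp ?_)
      refine tendsto_nhdsWithin_iff.2 ⟨?_, ?_⟩
      · have : Tendsto (fun δ : ℝ => δ * u) (nhds 0) (nhds (0 * u)) :=
          tendsto_id.mul_const u
        rw [zero_mul] at this
        exact this.mono_left nhdsWithin_le_nhds
      · filter_upwards [self_mem_nhdsWithin] with δ hδ
        exact mul_pos hδ hu0
  rw [integral_mul_const, integral_Ioi_cauchyWeight.2, one_mul] at hlim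
  refine hlim.congr' ?_
  filter_upwards [self_mem_nhdsWithin] with δ hδ
  exact integral_truncatedFiniteHilbert_mul_cauchyWeight x hδ hf

lemma ellipticKernel_den_ge {x y η : ℝ} (hy : y ∈ Ioo (-1 : ℝ) 1) (hη : 0 < η) :
    (x - y) ^ 2 + 2 * (1 - |x|) * η ≤ (x - y) ^ 2 + η * (2 + η - 2 * x * y) := by
  have h1 : x * y ≤ |x| := by
    calc x * y ≤ |x * y| := le_abs_self _
      _ = |x| * |y| := abs_mul _ _
      _ ≤ |x| * 1 := by gcongr; exact (abs_lt.2 hy).le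
      _ = |x| := mul_one _
  nlinarith [mul_nonneg hη.le (sub_nonneg.2 h1), sq_nonneg η]

lemma abs_ellipticKernel_sub_le {x y η : ℝ} (hx : x ∈ Ioo (-1 : ℝ) 1) (hy : y ∈ Ioo (-1 : ℝ) 1)
    (hη : 0 < η) :
    |ellipticKernel η x y - (x - y) / ((x - y) ^ 2 + 2 * η * (1 - x ^ 2))|
      ≤ 3 / (2 * (1 - |x|)) + 1 / (2 * (1 - |x|) ^ 2) := by
  have hb : 0 < 1 - |x| := sub_pos.2 (abs_lt.2 hx)
  set b := 1 - |x| with hbdef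
  have hD := ellipticKernel_den_ge (x := x) hy hη
  rw [← hbdef] at hD
  have hD' : (x - y) ^ 2 + 2 * b * η ≤ (x - y) ^ 2 + 2 * η * (1 - x ^ 2) := by
    have : b ≤ 1 - x ^ 2 := by
      rw [hbdef, ← sq_abs]; nlinarith [abs_nonneg x]
    nlinarith
  set D := (x - y) ^ 2 + η * (2 + η - 2 * x * y) with hDdef
  set D' := (x - y) ^ 2 + 2 * η * (1 - x ^ 2) with hDdef'
  have hP : 0 < (x - y) ^ 2 + 2 * b * η := by positivity
  have hD0 : 0 < D := hP.trans_le hD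
  have hD0' : 0 < D' := hP.trans_le hD'
  have e1 : η / D ≤ 1 / (2 * b) := by
    rw [div_le_div_iff₀ hD0 (by positivity)]; nlinarith [sq_nonneg (x - y)]
  have e2 : (x - y) ^ 2 / D' ≤ 1 := by
    rw [div_le_one hD0']; nlinarith [mul_pos hb hη]
  have e3 : η / D' ≤ 1 / (2 * b) := by
    rw [div_le_div_iff₀ hD0' (by positivity)]; nlinarith [sq_nonneg (x - y)]
  have hy1 : |y| ≤ 1 := (abs_lt.2 hy).le
  have hx1 : |x| ≤ 1 := (abs_lt.2 hx).le
  have ht : |x - y| ≤ 2 := (abs_sub x y).trans (by linarith)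
  have key : ellipticKernel η x y - (x - y) / D'
      = -(y * (η / D)) - 2 * x * (η / D * ((x - y) ^ 2 / D'))
        - (x - y) * (η / D * (η / D')) := by
    rw [ellipticKernel, ← hDdef]
    have hdd : D = D' + η * (η + 2 * x * (x - y)) := by rw [hDdef, hDdef']; ring
    field_simp
    linear_combination (-(x - y)) * hdd
  have f0 : 0 ≤ η / D := by positivity
  have f1 : |y * (η / D)| ≤ 1 / (2 * b) := by
    rw [abs_mul, abs_of_nonneg f0]
    calc |y| * (η / D) ≤ 1 * (1 / (2 * b)) := by gcongr
      _ = _ := one_mul _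
  have f2 : |2 * x * (η / D * ((x - y) ^ 2 / D'))| ≤ 2 * (1 / (2 * b) * 1) := by
    rw [abs_mul, abs_of_nonneg (by positivity : 0 ≤ η / D * ((x - y) ^ 2 / D')), abs_mul, abs_two]
    calc 2 * |x| * (η / D * ((x - y) ^ 2 / D')) ≤ 2 * 1 * (1 / (2 * b) * 1) := by gcongr
      _ = _ := by ring
  have f3 : |(x - y) * (η / D * (η / D'))| ≤ 2 * (1 / (2 * b) * (1 / (2 * b))) := by
    rw [abs_mul, abs_of_nonneg (by positivity : 0 ≤ η / D * (η / D'))]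
    gcongr
  rw [key]
  refine (abs_sub _ _).trans ((add_le_add_left (abs_sub _ _) _).trans ?_)
  rw [abs_neg]
  refine (add_le_add (add_le_add f1 f2) f3).trans (le_of_eq ?_)
  field_simp
  ring

lemma tendsto_integral_ellipticKernel {f : ℝ → ℝ} {x L : ℝ} (hx : x ∈ Ioo (-1 : ℝ) 1)
    (hf : IntegrableOn f (Ioo (-1 : ℝ) 1)) (hL : HasFiniteHilbertAt f x L) :
    Tendsto (fun η => 1 / π * ∫ y in Ioo (-1 : ℝ) 1, f y * ellipticKernel η x y)
      (nhdsWithin 0 (Ioi 0)) (nhds L) := by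
  have ha : 0 < 1 - x ^ 2 := by nlinarith [hx.1, hx.2]
  set B := 3 / (2 * (1 - |x|)) + 1 / (2 * (1 - |x|) ^ 2) with hB
  set E : ℝ → ℝ → ℝ := fun η y =>
    ellipticKernel η x y - (x - y) / ((x - y) ^ 2 + 2 * η * (1 - x ^ 2)) with hE
  have hEm : ∀ η, Measurable (E η) := fun η => by
    simp only [hE, ellipticKernel]; fun_prop
  have hEb : ∀ η, 0 < η → ∀ᵐ y ∂(volume.restrict (Ioo (-1 : ℝ) 1)), ‖E η y‖ ≤ B := by
    intro η hη
    filter_upwards [ae_restrict_mem measurableSet_Ioo] with y hy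
    exact abs_ellipticKernel_sub_le hx hy hη
  have hElim : Tendsto (fun η => ∫ y in Ioo (-1 : ℝ) 1, f y * E η y)
      (nhdsWithin 0 (Ioi 0)) (nhds (∫ y in Ioo (-1 : ℝ) 1, (0 : ℝ))) := by
    refine tendsto_integral_filter_of_dominated_convergence (fun y => |f y| * B) ?_ ?_
      (hf.abs.mul_const B) ?_
    · exact Eventually.of_forall fun η =>
        hf.aestronglyMeasurable.mul (hEm η).aestronglyMeasurable
    · filter_upwards [self_mem_nhdsWithin] with η hη
      filter_upwards [hEb η hη] with y hy
      rw [norm_mul, norm_eq_abs]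
      gcongr
    · have hne : ∀ᵐ y ∂(volume.restrict (Ioo (-1 : ℝ) 1)), y ≠ x :=
        ae_restrict_of_ae (by simp [ae_iff])
      filter_upwards [hne] with y hy
      have ht : (x - y) ^ 2 ≠ 0 := pow_ne_zero _ (sub_ne_zero.2 hy.symm)
      have hc : ContinuousAt (fun η => f y * E η y) 0 := by
        simp only [hE, ellipticKernel]
        refine continuousAt_const.mul (ContinuousAt.sub ?_ ?_)
        · exact ContinuousAt.div (by fun_prop) (by fun_prop) (by simpa using ht)
        · exact ContinuousAt.div (by fun_prop) (by fun_prop) (by simpa using ht)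
      have h0 : f y * E 0 y = 0 := by
        simp [hE, ellipticKernel]
      have := hc.tendsto
      rw [h0] at this
      exact this.mono_left nhdsWithin_le_nhds
  have hQ : Tendsto (fun η => 1 / π * ∫ y in Ioo (-1 : ℝ) 1,
      f y * ((x - y) / ((x - y) ^ 2 + 2 * η * (1 - x ^ 2)))) (nhdsWithin 0 (Ioi 0)) (nhds L) := by
    have hs : Tendsto (fun η => √(2 * η * (1 - x ^ 2))) (nhdsWithin 0 (Ioi 0))
        (nhdsWithin 0 (Ioi 0)) := by
      refine tendsto_nhdsWithin_iff.2 ⟨?_, ?_⟩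
      · have hc : Continuous fun η => √(2 * η * (1 - x ^ 2)) := by fun_prop
        have := hc.tendsto 0
        simp only [mul_zero, zero_mul, sqrt_zero] at this
        exact this.mono_left nhdsWithin_le_nhds
      · filter_upwards [self_mem_nhdsWithin] with η hη
        have : 0 < η := hη
        exact sqrt_pos.2 (by positivity)
    refine ((tendsto_conjPoisson hf hL).comp hs).congr' ?_
    filter_upwards [self_mem_nhdsWithin] with η hη
    have : 0 < η := hη
    simp only [Function.comp]
    rw [sq_sqrt (by positivity)]
  have hsum := hQ.add (hElim.const_mul (1 / π))
  rw [integral_zero, mul_zero, add_zero] at hsum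
  refine hsum.congr' ?_
  filter_upwards [self_mem_nhdsWithin] with η hη
  have hη0 : 0 < η := hη
  have hi1 : IntegrableOn (fun y => f y * E η y) (Ioo (-1 : ℝ) 1) :=
    hf.mul_bdd (hEm η).aestronglyMeasurable (hEb η hη)
  have hi2 : IntegrableOn (fun y => f y * ((x - y) / ((x - y) ^ 2 + 2 * η * (1 - x ^ 2))))
      (Ioo (-1 : ℝ) 1) := by
    refine hf.mul_bdd (c := 2 / (2 * η * (1 - x ^ 2)))
      (by fun_prop : Measurable fun y =>
        (x - y) / ((x - y) ^ 2 + 2 * η * (1 - x ^ 2))).aestronglyMeasurable ?_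
    filter_upwards [ae_restrict_mem measurableSet_Ioo] with y hy
    have hpos : 0 < 2 * η * (1 - x ^ 2) := by positivity
    rw [norm_eq_abs, abs_div, abs_of_pos (by positivity : 0 < (x - y) ^ 2 + 2 * η * (1 - x ^ 2))]
    gcongr
    · exact abs_le.2 ⟨by linarith [hx.1, hx.2, hy.1, hy.2], by linarith [hx.1, hx.2, hy.1, hy.2]⟩
    · nlinarith [sq_nonneg (x - y)]
  rw [← mul_add, ← integral_add hi2 hi1]
  congr 1
  refine integral_congr_ae (Eventually.of_forall fun y => ?_)
  simp only [hE]
  ring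

lemma hasSum_sin_series {g : ℝ → ℝ} (hg : IntegrableOn g (Ioo 0 π)) {r : ℝ} (hr0 : 0 < r)
    (hr1 : r < 1) (θ : ℝ) :
    HasSum (fun n : ℕ =>
        (2 / π * (r ^ (n + 1) * ∫ φ in Ioo 0 π, g φ * cos ((n + 1) * φ))) * sin ((n + 1) * θ))
      (-(sin θ * (1 / π * ∫ φ in Ioo 0 π,
        g φ * ellipticKernel ((1 - r) ^ 2 / (2 * r)) (cos θ) (cos φ)))) := by
  set F : ℕ → ℝ → ℝ := fun n φ =>
    g φ * (-(2 * (r ^ (n + 1) * (sin ((n + 1) * θ) * cos ((n + 1) * φ))))) with hF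
  have hb : ∀ (n : ℕ) (φ : ℝ),
      ‖-(2 * (r ^ (n + 1) * (sin ((n + 1) * θ) * cos ((n + 1) * φ))))‖ ≤ 2 * r ^ (n + 1) := by
    intro n φ
    rw [norm_neg, norm_mul, norm_mul, norm_mul, norm_pow]
    simp only [norm_eq_abs, abs_two, abs_of_pos hr0]
    have h1 := abs_sin_le_one ((n + 1) * θ)
    have h2 := abs_cos_le_one ((n + 1) * φ)
    calc 2 * (r ^ (n + 1) * (|sin ((n + 1) * θ)| * |cos ((n + 1) * φ)|))
        ≤ 2 * (r ^ (n + 1) * (1 * 1)) := by gcongr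
      _ = _ := by ring
  have hFi : ∀ n, IntegrableOn (F n) (Ioo 0 π) := fun n =>
    hg.mul_bdd (c := 2 * r ^ (n + 1)) (Continuous.aestronglyMeasurable (by fun_prop))
      (Eventually.of_forall (hb n))
  have hsum : Summable fun n => ∫ φ in Ioo 0 π, ‖F n φ‖ := by
    have hgeo : Summable fun n : ℕ => 2 * r ^ (n + 1) * ∫ φ in Ioo 0 π, ‖g φ‖ :=
      (((summable_nat_add_iff 1).2 (summable_geometric_of_lt_one hr0.le hr1)).mul_left 2).mul_right _
    refine hgeo.of_nonneg_of_le (fun n => integral_nonneg fun _ => norm_nonneg _) fun n => ?_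
    rw [← integral_const_mul]
    refine integral_mono (hFi n).norm (hg.norm.const_mul _) fun φ => ?_
    simp only [hF]
    rw [norm_mul, mul_comm]
    gcongr
    exact hb n φ
  have h := hasSum_integral_of_summable_integral_norm hFi hsum
  have hval : ∀ φ, ∑' n, F n φ
      = sin θ * (g φ * ellipticKernel ((1 - r) ^ 2 / (2 * r)) (cos θ) (cos φ)) := by
    intro φ
    rw [((hasSum_ellipticKernel hr0 hr1 θ φ).mul_left (g φ)).tsum_eq]
    ring
  simp_rw [hval] at h
  rw [integral_const_mul] at h
  have h' := h.mul_left (-(1 / π))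
  have hfun : (fun n : ℕ =>
      (2 / π * (r ^ (n + 1) * ∫ φ in Ioo 0 π, g φ * cos ((n + 1) * φ))) * sin ((n + 1) * θ))
      = fun n => -(1 / π) * ∫ φ in Ioo 0 π, F n φ := by
    funext n
    have hFn : F n = fun φ => -(2 * r ^ (n + 1) * sin ((n + 1) * θ)) *
        (g φ * cos ((n + 1) * φ)) := by
      funext φ; simp only [hF]; ring
    rw [hFn, integral_const_mul]
    ring
  rw [hfun]
  have hlim : -(1 / π) * (sin θ * ∫ φ in Ioo 0 π,
        g φ * ellipticKernel ((1 - r) ^ 2 / (2 * r)) (cos θ) (cos φ))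
      = -(sin θ * (1 / π * ∫ φ in Ioo 0 π,
        g φ * ellipticKernel ((1 - r) ^ 2 / (2 * r)) (cos θ) (cos φ))) := by ring
  rw [← hlim]
  exact h'

lemma cos_image_Ioo : cos '' Ioo 0 π = Ioo (-1) 1 := by
  ext x
  constructor
  · rintro ⟨θ, hθ, rfl⟩
    have hs := sin_pos_of_mem_Ioo hθ
    have h := sin_sq_add_cos_sq θ
    exact ⟨by nlinarith, by nlinarith⟩
  · intro hx
    refine ⟨arccos x, ⟨arccos_pos.2 hx.2, ?_⟩, cos_arccos hx.1.le hx.2.le⟩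
    refine lt_of_le_of_ne (arccos_le_pi x) fun h => ?_
    exact absurd (arccos_eq_pi.1 h) (not_le.2 hx.1)

lemma injOn_cos_Ioo : InjOn cos (Ioo 0 π) := injOn_cos.mono Ioo_subset_Icc_self

lemma integrableOn_Ioo_iff_comp_cos (h : ℝ → ℝ) :
    IntegrableOn h (Ioo (-1) 1) ↔ IntegrableOn (fun θ => sin θ * h (cos θ)) (Ioo 0 π) := by
  rw [← cos_image_Ioo, integrableOn_image_iff_integrableOn_abs_deriv_smul measurableSet_Ioo
    (fun θ _ => (hasDerivAt_cos θ).hasDerivWithinAt) injOn_cos_Ioo]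
  refine integrableOn_congr_fun (fun θ hθ => ?_) measurableSet_Ioo
  simp [abs_of_pos (sin_pos_of_mem_Ioo hθ)]

lemma setIntegral_Ioo_eq_comp_cos (h : ℝ → ℝ) :
    ∫ x in Ioo (-1) 1, h x = ∫ θ in Ioo 0 π, sin θ * h (cos θ) := by
  rw [← cos_image_Ioo, integral_image_eq_integral_abs_deriv_smul measurableSet_Ioo
    (fun θ _ => (hasDerivAt_cos θ).hasDerivWithinAt) injOn_cos_Ioo]
  refine setIntegral_congr_fun measurableSet_Ioo fun θ hθ => ?_
  simp [abs_of_pos (sin_pos_of_mem_Ioo hθ)]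

lemma setLIntegral_Ioo_eq_comp_cos (h : ℝ → ℝ) :
    ∫⁻ x in Ioo (-1) 1, ENNReal.ofReal (h x)
      = ∫⁻ θ in Ioo 0 π, ENNReal.ofReal (sin θ * h (cos θ)) := by
  rw [← cos_image_Ioo, lintegral_image_eq_lintegral_abs_deriv_mul measurableSet_Ioo
    (fun θ _ => (hasDerivAt_cos θ).hasDerivWithinAt) injOn_cos_Ioo]
  refine setLIntegral_congr_fun measurableSet_Ioo fun θ hθ => ?_
  have hs := sin_pos_of_mem_Ioo hθ
  simp only [abs_neg, abs_of_pos hs, ENNReal.ofReal_mul hs.le]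

lemma sin_mul_sq_mul_sqrt {θ : ℝ} (hθ : θ ∈ Ioo 0 π) (a : ℝ) :
    sin θ * (a ^ 2 * √(1 - cos θ ^ 2)) = (sin θ * a) ^ 2 := by
  rw [← sin_sq, sqrt_sq (sin_pos_of_mem_Ioo hθ).le]
  ring

lemma integrableOn_of_weighted_sq {f : ℝ → ℝ}
    (hmeas : AEStronglyMeasurable f (volume.restrict (Ioo (-1 : ℝ) 1)))
    (hL2 : IntegrableOn (fun x => f x ^ 2 * √(1 - x ^ 2)) (Ioo (-1 : ℝ) 1)) :
    IntegrableOn f (Ioo (-1 : ℝ) 1) := by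
  have hw : IntegrableOn (fun x : ℝ => (√(1 - x ^ 2))⁻¹) (Ioo (-1 : ℝ) 1) := by
    rw [integrableOn_Ioo_iff_comp_cos]
    refine (integrableOn_Ioo_of_continuous (continuous_const (y := (1 : ℝ))) 0 π).congr_fun
      (fun θ hθ => ?_) measurableSet_Ioo
    have hs := sin_pos_of_mem_Ioo hθ
    simp only
    rw [← sin_sq, sqrt_sq hs.le, mul_inv_cancel₀ hs.ne']
  refine (hL2.add hw).mono' hmeas ?_
  filter_upwards [ae_restrict_mem measurableSet_Ioo] with x hx
  have hs : 0 < √(1 - x ^ 2) := sqrt_pos.2 (by nlinarith [hx.1, hx.2])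
  rw [norm_eq_abs, Pi.add_apply, ← sub_nonneg]
  have hsq := sq_abs (f x)
  have : f x ^ 2 * √(1 - x ^ 2) + (√(1 - x ^ 2))⁻¹ - |f x|
      = ((|f x| * √(1 - x ^ 2) - 1) ^ 2 + |f x| * √(1 - x ^ 2)) / √(1 - x ^ 2) := by
    rw [← hsq]; field_simp; ring
  rw [this]
  positivity

lemma aemeasurable_integral_ellipticKernel {f : ℝ → ℝ}
    (hmeas : AEStronglyMeasurable f (volume.restrict (Ioo (-1 : ℝ) 1))) (η : ℝ) :
    AEMeasurable (fun x => 1 / π * ∫ y in Ioo (-1 : ℝ) 1, f y * ellipticKernel η x y)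
      (volume.restrict (Ioo (-1 : ℝ) 1)) := by
  have h1 : AEStronglyMeasurable (fun p : ℝ × ℝ => f p.2 * ellipticKernel η p.1 p.2)
      ((volume.restrict (Ioo (-1 : ℝ) 1)).prod (volume.restrict (Ioo (-1 : ℝ) 1))) := by
    refine hmeas.comp_snd.mul (Measurable.aestronglyMeasurable ?_)
    unfold ellipticKernel
    fun_prop
  exact h1.integral_prod_right'.aemeasurable.const_mul _

lemma lintegral_sq_integral_ellipticKernel_le {f : ℝ → ℝ}
    (hf : IntegrableOn f (Ioo (-1 : ℝ) 1))
    (hL2 : IntegrableOn (fun x => f x ^ 2 * √(1 - x ^ 2)) (Ioo (-1 : ℝ) 1))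
    {r : ℝ} (hr0 : 0 < r) (hr1 : r < 1) :
    ∫⁻ x in Ioo (-1 : ℝ) 1, ENNReal.ofReal ((1 / π * ∫ y in Ioo (-1 : ℝ) 1,
        f y * ellipticKernel ((1 - r) ^ 2 / (2 * r)) x y) ^ 2 * √(1 - x ^ 2))
      ≤ ENNReal.ofReal (∫ x in Ioo (-1 : ℝ) 1, f x ^ 2 * √(1 - x ^ 2)) := by
  set η := (1 - r) ^ 2 / (2 * r) with hη
  set g : ℝ → ℝ := fun θ => sin θ * f (cos θ) with hgdef
  have hg : IntegrableOn g (Ioo 0 π) := (integrableOn_Ioo_iff_comp_cos f).1 hf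
  have hg2 : IntegrableOn (fun θ => g θ ^ 2) (Ioo 0 π) :=
    ((integrableOn_Ioo_iff_comp_cos _).1 hL2).congr_fun
      (fun θ hθ => sin_mul_sq_mul_sqrt hθ _) measurableSet_Ioo
  have hA : ∫ x in Ioo (-1 : ℝ) 1, f x ^ 2 * √(1 - x ^ 2) = ∫ θ in Ioo 0 π, g θ ^ 2 := by
    rw [setIntegral_Ioo_eq_comp_cos]
    exact setIntegral_congr_fun measurableSet_Ioo fun θ hθ => sin_mul_sq_mul_sqrt hθ _
  have hV : ∀ x, ∫ y in Ioo (-1 : ℝ) 1, f y * ellipticKernel η x y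
      = ∫ φ in Ioo 0 π, g φ * ellipticKernel η x (cos φ) := by
    intro x
    rw [setIntegral_Ioo_eq_comp_cos]
    simp only [hgdef, mul_assoc]
  simp_rw [hV]
  rw [hA, setLIntegral_Ioo_eq_comp_cos]
  have hsq : ∫⁻ θ in Ioo 0 π, ENNReal.ofReal (sin θ * ((1 / π * ∫ φ in Ioo 0 π,
        g φ * ellipticKernel η (cos θ) (cos φ)) ^ 2 * √(1 - cos θ ^ 2)))
      = ∫⁻ θ in Ioo 0 π, ENNReal.ofReal ((-(sin θ * (1 / π * ∫ φ in Ioo 0 π,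
        g φ * ellipticKernel η (cos θ) (cos φ)))) ^ 2) := by
    refine setLIntegral_congr_fun measurableSet_Ioo fun θ hθ => ?_
    rw [sin_mul_sq_mul_sqrt hθ, neg_sq]
  rw [hsq]
  refine lintegral_sq_le_of_tendsto (u := fun N θ => ∑ n ∈ Finset.range N,
    (2 / π * (r ^ (n + 1) * ∫ φ in Ioo 0 π, g φ * cos ((n + 1) * φ))) * sin ((n + 1) * θ))
    (fun N => Continuous.aemeasurable (by fun_prop)) (fun N => ?_)
    (Eventually.of_forall fun θ => (hasSum_sin_series hg hr0 hr1 θ).tendsto_sum_nat)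
  rw [← ofReal_integral_eq_lintegral_ofReal (integrableOn_Ioo_of_continuous (by fun_prop) _ _)
    (Eventually.of_forall fun θ => sq_nonneg _)]
  exact ENNReal.ofReal_le_ofReal (integral_sq_sin_series_le hg hg2 hr0.le hr1.le N)

lemma exists_seq_tendsto_one :
    ∃ r : ℕ → ℝ, (∀ k, 0 < r k) ∧ (∀ k, r k < 1) ∧
      Tendsto (fun k => (1 - r k) ^ 2 / (2 * r k)) atTop (nhdsWithin 0 (Ioi 0)) := by
  obtain ⟨r, -, hr, hlim⟩ := exists_seq_strictMono_tendsto' (zero_lt_one (α := ℝ))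
  refine ⟨r, fun k => (hr k).1, fun k => (hr k).2, tendsto_nhdsWithin_iff.2 ⟨?_, ?_⟩⟩
  · have hc : ContinuousAt (fun t : ℝ => (1 - t) ^ 2 / (2 * t)) 1 :=
      ContinuousAt.div (by fun_prop) (by fun_prop) (by norm_num)
    simpa [Function.comp_def] using hc.tendsto.comp hlim
  · refine Eventually.of_forall fun k => ?_
    have h1 := (hr k).1
    have h2 := sub_pos.2 (hr k).2
    exact mem_Ioi.2 (by positivity)

/-- If `f(x)(1-x²)^{1/4} ∈ L²(-1,1)` and `Hf` is the finite Hilbert transform of `f`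
(existing a.e. on `(-1,1)`), then the weighted `L²` norm does not increase:
`∫_{-1}^1 (Hf)² √(1-x²) dx ≤ ∫_{-1}^1 f² √(1-x²) dx`. -/
theorem hilbert_weighted_contraction (f Hf : ℝ → ℝ)
    (hmeas : AEStronglyMeasurable f (volume.restrict (Ioo (-1 : ℝ) 1)))
    (hL2 : IntegrableOn (fun x => f x ^ 2 * Real.sqrt (1 - x ^ 2)) (Ioo (-1 : ℝ) 1))
    (hH : ∀ᵐ x ∂(volume.restrict (Ioo (-1 : ℝ) 1)), HasFiniteHilbertAt f x (Hf x)) :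
    ∫ x in Ioo (-1 : ℝ) 1, Hf x ^ 2 * Real.sqrt (1 - x ^ 2)
      ≤ ∫ x in Ioo (-1 : ℝ) 1, f x ^ 2 * Real.sqrt (1 - x ^ 2) := by
  have hf := integrableOn_of_weighted_sq hmeas hL2
  have hrhs : 0 ≤ ∫ x in Ioo (-1 : ℝ) 1, f x ^ 2 * √(1 - x ^ 2) :=
    integral_nonneg fun x => by positivity
  by_cases hint : IntegrableOn (fun x => Hf x ^ 2 * √(1 - x ^ 2)) (Ioo (-1 : ℝ) 1)
  swap
  · rwa [integral_undef hint]
  obtain ⟨r, hr0, hr1, hr⟩ := exists_seq_tendsto_one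
  have hsq : ∀ v x : ℝ, (v * √√(1 - x ^ 2)) ^ 2 = v ^ 2 * √(1 - x ^ 2) := fun v x => by
    rw [mul_pow, sq_sqrt (sqrt_nonneg _)]
  have key : ∫⁻ x in Ioo (-1 : ℝ) 1, ENNReal.ofReal ((Hf x * √√(1 - x ^ 2)) ^ 2)
      ≤ ENNReal.ofReal (∫ x in Ioo (-1 : ℝ) 1, f x ^ 2 * √(1 - x ^ 2)) := by
    refine lintegral_sq_le_of_tendsto (u := fun k x => (1 / π * ∫ y in Ioo (-1 : ℝ) 1,
      f y * ellipticKernel ((1 - r k) ^ 2 / (2 * r k)) x y) * √√(1 - x ^ 2))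
      (fun k => (aemeasurable_integral_ellipticKernel hmeas _).mul
        (Continuous.aemeasurable (by fun_prop))) (fun k => ?_) ?_
    · simp_rw [hsq]
      exact lintegral_sq_integral_ellipticKernel_le hf hL2 (hr0 k) (hr1 k)
    · filter_upwards [hH, ae_restrict_mem measurableSet_Ioo] with x hx hmem
      exact ((tendsto_integral_ellipticKernel hmem hf hx).comp hr).mul_const _
  simp_rw [hsq] at key
  rw [← ofReal_integral_eq_lintegral_ofReal hint
    (Eventually.of_forall fun x => by positivity)] at key
  exact (ENNReal.ofReal_le_ofReal_iff hrhs).1 key
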